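/- arXiv:2507.01669 — 2 statements merged into one kernel-verified Lean document; each statement's English description precedes it below -/
import Mathlib

section
/- Let n ≥ 1, π ∈ S_{n+1} and 1 ≤ i ≤ n. Set j = min(π^{-1}(i), π^{-1}(i+1)), and let π̃ ∈ S_n be obtained from π by removing the assignment j ↦ π(j). Then s_{j−1} u_{π̃} = (γ_i)_* u_π in 𝕀^n. -/
/-- An `m`-simplex of the simplicial cube `𝕀^n`: for each of the `n` coordinates we record
the number of elements of `{0,…,m}` sent to `0` by the corresponding order-preserving map
`{0,…,m} → {0,1}` (a number in `{0,…,m+1}`).  Equivalently, this is the partition form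
`(u_0,…,u_{m+1})`, where coordinate `i` belongs to the part `u_{k_i}`. -/
abbrev CubeSimplex (n m : ℕ) : Type := Fin n → Fin (m + 2)

/-- The face operator `d_j : (𝕀^n)_{m+1} → (𝕀^n)_m`, `0 ≤ j ≤ m+1`. -/
def cubeFace {n m : ℕ} (j : Fin (m + 2)) (u : CubeSimplex n (m + 1)) : CubeSimplex n m :=
  fun i =>
    if h : (u i : ℕ) ≤ (j : ℕ) then ⟨(u i : ℕ), by have := j.isLt; omega⟩
    else ⟨(u i : ℕ) - 1, by have := (u i).isLt; omega⟩

/-- The degeneracy operator `s_j : (𝕀^n)_m → (𝕀^n)_{m+1}` (the index `j` is given as a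
natural number; only `0 ≤ j ≤ m` is geometrically meaningful). -/
def cubeDegen {n m : ℕ} (j : ℕ) (u : CubeSimplex n m) : CubeSimplex n (m + 1) :=
  fun i => if (u i : ℕ) ≤ j then (u i).castSucc else (u i).succ

/-- The action `𝕀^n(f) : (𝕀^n)_{m'} → (𝕀^n)_m` of a morphism `f : [m] → [m']` of the
simplex category on the simplices of `𝕀^n` (precomposition of each coordinate with `f`). -/
def cubeAct {n m m' : ℕ} (f : Fin (m + 1) →o Fin (m' + 1)) (u : CubeSimplex n m') :
    CubeSimplex n m :=
  fun i =>
    ⟨(Finset.univ.filter fun x : Fin (m + 1) => (f x : ℕ) < (u i : ℕ)).card, by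
      have h := Finset.card_filter_le (Finset.univ : Finset (Fin (m + 1)))
        (fun x : Fin (m + 1) => (f x : ℕ) < (u i : ℕ))
      have h2 : (Finset.univ : Finset (Fin (m + 1))).card = m + 1 := by simp
      omega⟩

/-- The non-degenerate `n`-simplex `u_π` of `𝕀^n` attached to a permutation `π ∈ S_n`;
in partition form it is `(∅, {π(1)}, …, {π(n)}, ∅)`: the coordinate with (0-based) index
`i` lies in the part with index `π⁻¹(i) + 1`. -/
def uPerm {n : ℕ} (π : Equiv.Perm (Fin n)) : CubeSimplex n n :=
  fun i => ⟨(π.symm i : ℕ) + 1, by have := (π.symm i).isLt; omega⟩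

/-- `IsRemoval π i πt` says that `πt ∈ S_n` is obtained from `π ∈ S_{n+1}` by removing the
assignment `i ↦ π(i)` (everything 0-based): remaining entries are renumbered, preserving
the mappings between them. -/
def IsRemoval {n : ℕ} (π : Equiv.Perm (Fin (n + 1))) (i : Fin (n + 1))
    (πt : Equiv.Perm (Fin n)) : Prop :=
  ∀ j : Fin n,
    (πt j : ℕ) =
      if (j : ℕ) < (i : ℕ) then
        (if (π j.castSucc : ℕ) < (π i : ℕ) then (π j.castSucc : ℕ) else (π j.castSucc : ℕ) - 1)
      else
        (if (π j.succ : ℕ) < (π i : ℕ) then (π j.succ : ℕ) else (π j.succ : ℕ) - 1)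

/-- The connection map `(γ_i)_* : 𝕀^{n+1} → 𝕀^n`, replacing the coordinates `i` and `i+1`
by their pointwise minimum (0-based coordinate `i`; in the present encoding the pointwise
minimum of two coordinate maps corresponds to the maximum of their numbers of zeros). -/
def gammaStar {n m : ℕ} (i : Fin n) (u : CubeSimplex (n + 1) m) : CubeSimplex n m :=
  fun x =>
    if (x : ℕ) < (i : ℕ) then u x.castSucc
    else if (x : ℕ) = (i : ℕ) then max (u i.castSucc) (u i.succ)
    else u x.succ

/-- The removal of `j` from `π` restricts `π` along the order embedding skipping `j`, up to
renumbering of the values by the order embedding skipping `π j`. -/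
theorem IsRemoval.succAbove_apply {n : ℕ} {π : Equiv.Perm (Fin (n + 1))} {j : Fin (n + 1)}
    {πt : Equiv.Perm (Fin n)} (h : IsRemoval π j πt) (p : Fin n) :
    π (j.succAbove p) = (π j).succAbove (πt p) := by
  have hne : (π (j.succAbove p) : ℕ) ≠ π j := fun e =>
    j.succAbove_ne p (π.injective (Fin.ext e))
  have hp := h p
  apply Fin.ext
  by_cases hlt : (p : ℕ) < j
  · rw [Fin.succAbove_of_castSucc_lt j p hlt] at hne ⊢
    simp only [hlt, if_true] at hp
    simp only [Fin.succAbove, Fin.lt_def, Fin.val_castSucc]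
    split_ifs at hp ⊢ <;> simp only [Fin.val_castSucc, Fin.val_succ] <;> omega
  · rw [Fin.succAbove_of_le_castSucc j p (not_lt.mp hlt)] at hne ⊢
    simp only [hlt, if_false] at hp
    simp only [Fin.succAbove, Fin.lt_def, Fin.val_castSucc]
    split_ifs at hp ⊢ <;> simp only [Fin.val_castSucc, Fin.val_succ] <;> omega

/-- The degeneracy `s_j` of `u_π` records the positions of `π⁻¹` renumbered by skipping `j`. -/
theorem cubeDegen_uPerm_apply {n : ℕ} (j : Fin (n + 1)) (π : Equiv.Perm (Fin n)) (x : Fin n) :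
    cubeDegen (j : ℕ) (uPerm π) x = (j.succAbove (π.symm x)).succ.castSucc := by
  apply Fin.ext
  simp only [cubeDegen, uPerm, Fin.succAbove, Fin.lt_def, Fin.val_castSucc, Nat.succ_le_iff]
  split_ifs <;> simp

theorem uPerm_apply {n : ℕ} (π : Equiv.Perm (Fin n)) (x : Fin n) :
    uPerm π x = (π.symm x).succ.castSucc := rfl

/-- Let `n ≥ 1`, `π ∈ S_{n+1}` and `1 ≤ i ≤ n` (the latter encoded by
`i : Fin n`, 0-based).  Set `j = min(π⁻¹(i), π⁻¹(i+1))` and let `π̃ ∈ S_n` be obtained from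
`π` by removing the assignment `j ↦ π(j)`.  Then `s_{j-1} u_{π̃} = (γ_i)_* u_π` in `𝕀^n`
(0-based: the degeneracy index `j - 1` is the 0-based position `j₀`). -/
theorem szczarba_stmt11 (n : ℕ) (i : Fin n) (π : Equiv.Perm (Fin (n + 1)))
    (πt : Equiv.Perm (Fin n)) (j : Fin (n + 1))
    (hj : j = min (π.symm i.castSucc) (π.symm i.succ))
    (hrem : IsRemoval π j πt) :
    cubeDegen ((j : ℕ)) (uPerm πt) = gammaStar i (uPerm π) := by
  funext x
  rw [cubeDegen_uPerm_apply]
  have hq := hrem.succAbove_apply (πt.symm x)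
  rw [Equiv.apply_symm_apply, ← Equiv.eq_symm_apply] at hq
  rw [hq]
  simp only [gammaStar, uPerm_apply]
  rcases le_total (π.symm i.castSucc) (π.symm i.succ) with hle | hle
  · rw [min_eq_left hle] at hj
    rw [max_eq_right (Fin.castSucc_le_castSucc_iff.mpr (Fin.succ_le_succ_iff.mpr hle)), hj, Equiv.apply_symm_apply]
    split_ifs with h₁ h₂
    · rw [Fin.succAbove_of_castSucc_lt _ _ h₁]
    · rw [Fin.ext h₂, Fin.succAbove_of_le_castSucc _ _ le_rfl]
    · rw [Fin.succAbove_of_le_castSucc _ _ (not_lt.mp h₁)]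
  · rw [min_eq_right hle] at hj
    rw [max_eq_left (Fin.castSucc_le_castSucc_iff.mpr (Fin.succ_le_succ_iff.mpr hle)), hj, Equiv.apply_symm_apply]
    split_ifs with h₁ h₂
    · rw [Fin.succAbove_of_castSucc_lt]
      simp only [Fin.lt_def, Fin.val_castSucc, Fin.val_succ]
      omega
    · rw [Fin.ext h₂, Fin.succAbove_of_castSucc_lt _ _ i.castSucc_lt_succ]
    · rw [Fin.succAbove_of_le_castSucc]
      simp only [Fin.le_def, Fin.val_castSucc, Fin.val_succ]
      omega
end

section
/- Let n ≥ 1 and 𝐢 ∈ 𝐒_n, write π = p(𝐢) ∈ S_n, and let Ξ(𝐢) = ((α,β), 𝐣, 𝐤) ∈ Shuff(k,l) × 𝐒_k × 𝐒_l. Then k = π(n) − 1 and l = n − π(n), the sequence α consists of the indices mapped by π to values less than π(n) and β consists of the indices mapped by π to values greater than π(n), and Ψ_{k,l}((α,β), p(𝐣), p(𝐤)) = π̃, where π̃ ∈ S_{n−1} is obtained from π by removing the assignment n ↦ π(n). -/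
/-- `𝐒_n = [n-1] × [n-2] × ⋯ × [0]`: the sequences `(i_1,…,i_n)` with `0 ≤ i_k ≤ n-k`. -/
abbrev SzIndex (n : ℕ) := ∀ k : Fin n, Fin (n - (k : ℕ))

/-- The tail `(i_2,…,i_n)` of a sequence `(i_1,…,i_n) ∈ 𝐒_n`. -/
def szTail {n : ℕ} (i : SzIndex (n + 1)) : SzIndex n :=
  fun k => Fin.cast (Nat.succ_sub_succ n k) (i k.succ)

/-- The permutation of `Fin (n+1)` sending `0` to `v` and `j+1` to `e(j)`, where values
`≥ v` are shifted up by one (i.e. obtained from `e` by adding the assignment `0 ↦ v`). -/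
def insertPerm {n : ℕ} (v : Fin (n + 1)) (e : Equiv.Perm (Fin n)) :
    Equiv.Perm (Fin (n + 1)) :=
  (finSuccEquiv n).trans ((Equiv.optionCongr e).trans (finSuccEquiv' v).symm)

/-- The map `p : 𝐒_n → S_n`, defined recursively by `π(1) = i_1 + 1` and
`π(k) = π'(k-1)` resp. `π'(k-1) + 1` according to whether `π'(k-1) ≤ i_1`,
where `π' = p(i_2,…,i_n)` (here realized 0-based on `Fin n`). -/
def pMap : ∀ n : ℕ, SzIndex n → Equiv.Perm (Fin n)
  | 0, _ => 1
  | n + 1, i => insertPerm (i ⟨0, Nat.succ_pos n⟩) (pMap n (szTail i))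

/-- A `(k,l)`-shuffle: a pair `(α,β)` of strictly increasing sequences partitioning
`{1,…,k+l}` (represented 0-based as `Fin (k+l)`). -/
structure Shuffle (k l : ℕ) where
  α : Fin k → Fin (k + l)
  β : Fin l → Fin (k + l)
  monoα : StrictMono α
  monoβ : StrictMono β
  disjoint : ∀ a b, α a ≠ β b
  cover : ∀ x, (∃ a, α a = x) ∨ (∃ b, β b = x)

/-- The concatenation `σ ⊔ τ ∈ S_{k+l}` of permutations `σ ∈ S_k` and `τ ∈ S_l`,
acting as `σ` on the first `k` letters and as the shift of `τ` on the last `l` letters. -/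
def permConcat {k l : ℕ} (σ : Equiv.Perm (Fin k)) (τ : Equiv.Perm (Fin l)) :
    Equiv.Perm (Fin (k + l)) :=
  finSumFinEquiv.symm.trans ((Equiv.sumCongr σ τ).trans finSumFinEquiv)

/-- The graph of Szczarba's bijection
`Ξ : 𝐒_n → ⨆_{k+l=n−1} Shuff(k,l) × 𝐒_k × 𝐒_l` (`n ≥ 1`), defined recursively:
for `n = 1` both sides are singletons; for `n ≥ 2` and `𝐢 = (i_1, 𝐢')` with
`Ξ(𝐢') = ((α',β'), 𝐣', 𝐤') ∈ Shuff(k',l') × 𝐒_{k'} × 𝐒_{l'}`: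
if `0 ≤ i_1 ≤ k'` then `Ξ(𝐢) = (({1} ∪ (α'+1), β'+1), (i_1,𝐣'), 𝐤')` with `k = k'+1`,
`l = l'`; if `k' < i_1 ≤ n−1` then `Ξ(𝐢) = ((α'+1, {1} ∪ (β'+1)), 𝐣', (i_1−k'−1, 𝐤'))`
with `k = k'`, `l = l'+1`.  (The shift by one accounts for the renumbering of the
positions of `π` relative to those of `π'`; everything is 0-based below.) -/
inductive XiRel : ∀ (n k l : ℕ), SzIndex n → Shuffle k l → SzIndex k → SzIndex l → Prop
  | base (i : SzIndex 1) (sh : Shuffle 0 0) (jj : SzIndex 0) (kk : SzIndex 0) :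
      XiRel 1 0 0 i sh jj kk
  | left {n k' l' : ℕ} (i : SzIndex (n + 2)) (sh' : Shuffle k' l')
      (jj' : SzIndex k') (kk : SzIndex l')
      (sh : Shuffle (k' + 1) l') (jj : SzIndex (k' + 1))
      (hrec : XiRel (n + 1) k' l' (szTail i) sh' jj' kk)
      (hhead : (i ⟨0, Nat.succ_pos (n + 1)⟩ : ℕ) ≤ k')
      (hα0 : (sh.α ⟨0, Nat.succ_pos k'⟩ : ℕ) = 0)
      (hα : ∀ t : Fin k', (sh.α t.succ : ℕ) = (sh'.α t : ℕ) + 1)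
      (hβ : ∀ t : Fin l', (sh.β t : ℕ) = (sh'.β t : ℕ) + 1)
      (hj0 : (jj ⟨0, Nat.succ_pos k'⟩ : ℕ) = (i ⟨0, Nat.succ_pos (n + 1)⟩ : ℕ))
      (hj : ∀ t : Fin k', (jj t.succ : ℕ) = (jj' t : ℕ)) :
      XiRel (n + 2) (k' + 1) l' i sh jj kk
  | right {n k' l' : ℕ} (i : SzIndex (n + 2)) (sh' : Shuffle k' l')
      (jj : SzIndex k') (kk' : SzIndex l')
      (sh : Shuffle k' (l' + 1)) (kk : SzIndex (l' + 1))
      (hrec : XiRel (n + 1) k' l' (szTail i) sh' jj kk')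
      (hhead : k' < (i ⟨0, Nat.succ_pos (n + 1)⟩ : ℕ))
      (hα : ∀ t : Fin k', (sh.α t : ℕ) = (sh'.α t : ℕ) + 1)
      (hβ0 : (sh.β ⟨0, Nat.succ_pos l'⟩ : ℕ) = 0)
      (hβ : ∀ t : Fin l', (sh.β t.succ : ℕ) = (sh'.β t : ℕ) + 1)
      (hk0 : (kk ⟨0, Nat.succ_pos l'⟩ : ℕ) = (i ⟨0, Nat.succ_pos (n + 1)⟩ : ℕ) - k' - 1)
      (hkk : ∀ t : Fin l', (kk t.succ : ℕ) = (kk' t : ℕ)) :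
      XiRel (n + 2) k' (l' + 1) i sh jj kk

theorem insertPerm_zero {n : ℕ} (v : Fin (n + 1)) (e : Equiv.Perm (Fin n)) :
    insertPerm v e 0 = v := by
  simp [insertPerm]

theorem insertPerm_succ {n : ℕ} (v : Fin (n + 1)) (e : Equiv.Perm (Fin n)) (j : Fin n) :
    insertPerm v e j.succ = v.succAbove (e j) := by
  simp [insertPerm]

theorem pMap_succ_zero {n : ℕ} (i : SzIndex (n + 1)) (p : Fin (n + 1)) (hp : (p : ℕ) = 0) :
    (pMap (n + 1) i p : ℕ) = (i ⟨0, Nat.succ_pos n⟩ : ℕ) := by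
  obtain rfl : p = 0 := Fin.ext hp
  rw [pMap, insertPerm_zero]

theorem pMap_succ_succ {n : ℕ} (i : SzIndex (n + 1)) (p : Fin (n + 1)) (q : Fin n)
    (hp : (p : ℕ) = q + 1) :
    (pMap (n + 1) i p : ℕ) =
      if (pMap n (szTail i) q : ℕ) < (i ⟨0, Nat.succ_pos n⟩ : ℕ) then
        (pMap n (szTail i) q : ℕ) else (pMap n (szTail i) q : ℕ) + 1 := by
  obtain rfl : p = q.succ := Fin.ext hp
  rw [pMap, insertPerm_succ, Fin.succAbove]
  simp only [Fin.lt_def, Fin.val_castSucc]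
  split_ifs <;> simp

theorem szTail_eq_of_val_succ {n : ℕ} {i : SzIndex (n + 1)} {j : SzIndex n}
    (h : ∀ t : Fin n, (i t.succ : ℕ) = (j t : ℕ)) : szTail i = j :=
  funext fun t => Fin.ext (h t)

/-- The values of `p(𝐢)` at the last position and along both parts of the shuffle,
in terms of the other components of `Ξ(𝐢)`. -/
theorem XiRel.pMap_values {N k l : ℕ} {i : SzIndex N} {sh : Shuffle k l}
    {jj : SzIndex k} {kk : SzIndex l} (h : XiRel N k l i sh jj kk) :
    N = k + l + 1 ∧
    (∀ p : Fin N, (p : ℕ) = k + l → (pMap N i p : ℕ) = k) ∧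
    (∀ (a : Fin k) (p : Fin N), (p : ℕ) = sh.α a → (pMap N i p : ℕ) = pMap k jj a) ∧
    (∀ (b : Fin l) (p : Fin N), (p : ℕ) = sh.β b →
      (pMap N i p : ℕ) = k + 1 + pMap l kk b) := by
  induction h with
  | base i sh jj kk => exact ⟨rfl, fun p _ => by omega, fun a => a.elim0, fun b => b.elim0⟩
  | @left n k' l' i sh' jj' kk sh jj _ hhead hα0 hα hβ hj0 hj ih =>
    obtain ⟨hN, hlast, ihα, ihβ⟩ := ih
    have htail := szTail_eq_of_val_succ hj
    refine ⟨by omega, fun p hp => ?_, fun a p hp => ?_, fun b p hp => ?_⟩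
    · have hq := hlast ⟨k' + l', by omega⟩ rfl
      rw [pMap_succ_succ i p ⟨k' + l', by omega⟩ (by simp only; omega), hq, if_neg (by omega)]
    · cases a using Fin.cases with
      | zero => rw [pMap_succ_zero i p (hp.trans hα0), pMap_succ_zero jj _ rfl, hj0]
      | succ t =>
        have hlt := (sh'.α t).isLt
        rw [pMap_succ_succ i p ⟨sh'.α t, by omega⟩ (hp.trans (hα t)),
          pMap_succ_succ jj _ t rfl, ihα t _ rfl, htail, hj0]
    · have hlt := (sh'.β b).isLt
      rw [pMap_succ_succ i p ⟨sh'.β b, by omega⟩ (hp.trans (hβ b)), ihβ b _ rfl,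
        if_neg (by omega)]
      omega
  | @right n k' l' i sh' jj kk' sh kk _ hhead hα hβ0 hβ hk0 hkk ih =>
    obtain ⟨hN, hlast, ihα, ihβ⟩ := ih
    have htail := szTail_eq_of_val_succ hkk
    refine ⟨by omega, fun p hp => ?_, fun a p hp => ?_, fun b p hp => ?_⟩
    · have hq := hlast ⟨k' + l', by omega⟩ rfl
      rw [pMap_succ_succ i p ⟨k' + l', by omega⟩ (by simp only; omega), hq, if_pos hhead]
    · have hlt := (sh'.α a).isLt
      have hval := (pMap k' jj a).isLt
      rw [pMap_succ_succ i p ⟨sh'.α a, by omega⟩ (hp.trans (hα a)), ihα a _ rfl,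
        if_pos (by omega)]
    · cases b using Fin.cases with
      | zero =>
        rw [pMap_succ_zero i p (hp.trans hβ0), pMap_succ_zero kk _ rfl, hk0]
        omega
      | succ t =>
        have hlt := (sh'.β t).isLt
        rw [pMap_succ_succ i p ⟨sh'.β t, by omega⟩ (hp.trans (hβ t)),
          pMap_succ_succ kk _ t rfl, ihβ t _ rfl, htail, hk0]
        split_ifs <;> omega

/-- Let `n+1 ≥ 1`, `𝐢 ∈ 𝐒_{n+1}`, `π = p(𝐢) ∈ S_{n+1}`, and let
`Ξ(𝐢) = ((α,β), 𝐣, 𝐤) ∈ Shuff(k,l) × 𝐒_k × 𝐒_l` (so `k + l = n`).  Then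
`k = π(n+1) − 1` and `l = (n+1) − π(n+1)`, the sequence `α` consists of the positions
mapped by `π` to values less than `π(n+1)` and `β` of those mapped to values greater than
`π(n+1)`, and `Ψ_{k,l}((α,β), p(𝐣), p(𝐤)) = π̃`, where `π̃ ∈ S_n` is obtained from `π` by
removing the assignment `n+1 ↦ π(n+1)` (0-based: the last position `Fin.last n`).  As in
Statement 0, the equation `π̃ = (p(𝐣) ⊔ p(𝐤)) ∘ π_{α,β}` is expressed by composing with
the inverse `x ↦ Sum.elim α β (finSumFinEquiv.symm x)` of `π_{α,β}`. -/
theorem szczarba_stmt16 (n k l : ℕ) (i : SzIndex (n + 1)) (sh : Shuffle k l)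
    (jj : SzIndex k) (kk : SzIndex l)
    (hXi : XiRel (n + 1) k l i sh jj kk) (hkl : k + l = n)
    (π : Equiv.Perm (Fin (n + 1))) (hπ : π = pMap (n + 1) i)
    (πt : Equiv.Perm (Fin n)) (hπt : IsRemoval π (Fin.last n) πt) :
    k = (π (Fin.last n) : ℕ) ∧
    l = n - (π (Fin.last n) : ℕ) ∧
    (∀ a : Fin k,
      (π ⟨(sh.α a : ℕ), by have := (sh.α a).isLt; omega⟩ : ℕ) < (π (Fin.last n) : ℕ)) ∧
    (∀ b : Fin l,
      (π (Fin.last n) : ℕ) < (π ⟨(sh.β b : ℕ), by have := (sh.β b).isLt; omega⟩ : ℕ)) ∧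
    (∀ x : Fin (k + l),
      (πt ⟨((Sum.elim sh.α sh.β (finSumFinEquiv.symm x) : Fin (k + l)) : ℕ), by
          have := (Sum.elim sh.α sh.β (finSumFinEquiv.symm x)).isLt; omega⟩ : ℕ) =
        (permConcat (pMap k jj) (pMap l kk) x : ℕ)) := by
  subst hπ
  obtain ⟨-, hlast, hα, hβ⟩ := hXi.pMap_values
  have hl : (pMap (n + 1) i (Fin.last n) : ℕ) = k := hlast _ (by simp [hkl])
  refine ⟨hl.symm, by omega, fun a => ?_, fun b => ?_, fun x => ?_⟩
  · rw [hα a _ rfl, hl]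
    exact (pMap k jj a).isLt
  · rw [hl, hβ b _ rfl]
    omega
  · rw [hπt, if_pos (by simpa [hkl] using (Sum.elim sh.α sh.β (finSumFinEquiv.symm x)).isLt), hl]
    obtain ⟨y, rfl⟩ := finSumFinEquiv.surjective x
    cases y with
    | inl a =>
      have hval := (pMap k jj a).isLt
      rw [hα a _ (by simp), if_pos hval]
      simp [permConcat]
    | inr b =>
      rw [hβ b _ (by simp), if_neg (by omega)]
      simp [permConcat]
end
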